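/- arXiv:2407.15210 — 3 statements merged into one kernel-verified Lean document; each statement's English description precedes it below -/
import Mathlib

section
/- If 0 < a ≤ 1/e, then the set of representable elements of the extended real line EReal is a closed subset of EReal. -/
open Filter Topology

/-- Exponential on the extended real line, with e^{-∞}=0 and e^{+∞}=+∞. -/
noncomputable def eexp (y : EReal) : EReal :=
  if y = ⊥ then (0 : EReal) else if y = ⊤ then ⊤ else ((Real.exp y.toReal : ℝ) : EReal)

/-- `fSgn a s` is `f₊ : x ↦ e^{a·x}` when `s = true` and `f₋ : x ↦ -e^{a·x}` when `s = false`. -/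
noncomputable def fSgn (a : ℝ) (s : Bool) (x : EReal) : EReal :=
  if s then eexp ((a : EReal) * x) else -eexp ((a : EReal) * x)

/-- `uSeq a n ε = f_{ε₁}(f_{ε₂}(⋯ f_{ε_n}(1)⋯))`, where `ε (k-1)` is the k-th sign. -/
noncomputable def uSeq (a : ℝ) : ℕ → (ℕ → Bool) → EReal
  | 0, _ => 1
  | n + 1, ε => fSgn a (ε 0) (uSeq a n (fun k => ε (k + 1)))

/-- `ε` represents `t` if `(u_{n,ε})_n` tends to `t` in `EReal`. -/
def Represents (a : ℝ) (ε : ℕ → Bool) (t : EReal) : Prop :=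
  Filter.Tendsto (fun n => uSeq a n ε) Filter.atTop (nhds t)

/-- `t` is representable if some sign sequence represents it. -/
def Representable (a : ℝ) (t : EReal) : Prop :=
  ∃ ε : ℕ → Bool, Represents a ε t

/-- For a finite word `γ = γ₁⋯γ_k`, `fWord a γ = f_{γ₁} ∘ ⋯ ∘ f_{γ_k}`. -/
noncomputable def fWord (a : ℝ) (γ : List Bool) (x : EReal) : EReal :=
  γ.foldr (fSgn a) x

/-- `I(ε) = ⋂ₙ I(n,ε)` where `I(n,ε)` is the image of `EReal` under `f_{ε₁} ∘ ⋯ ∘ f_{ε_n}`. -/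
noncomputable def Iset (a : ℝ) (ε : ℕ → Bool) : Set EReal :=
  ⋂ n : ℕ, Set.range (fWord a (List.ofFn fun i : Fin n => ε i))

/-- `X` is the union over all finite words `γ` of the images `f_γ(]m,+∞])`. -/
noncomputable def Xset (a m : ℝ) : Set EReal :=
  ⋃ γ : List Bool, fWord a γ '' Set.Ioi (m : EReal)

/-- Real-valued version of `uSeq`. -/
noncomputable def vSeq (a : ℝ) : ℕ → (ℕ → Bool) → ℝ
  | 0, _ => 1
  | n + 1, ε => (if ε 0 then (1 : ℝ) else -1) * Real.exp (a * vSeq a n (fun k => ε (k + 1)))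

/-- Contraction modulus. -/
noncomputable def phiMod (d : ℝ) : ℝ := Real.exp 1 * (1 - Real.exp (-(d / Real.exp 1)))

lemma fSgn_coe (a : ℝ) (s : Bool) (x : ℝ) :
    fSgn a s (x : EReal) = (((if s then (1 : ℝ) else -1) * Real.exp (a * x) : ℝ) : EReal) := by
  have h : eexp ((a : EReal) * (x : EReal)) = ((Real.exp (a * x) : ℝ) : EReal) := by
    rw [← EReal.coe_mul]
    unfold eexp
    rw [if_neg (EReal.coe_ne_bot _), if_neg (EReal.coe_ne_top _), EReal.toReal_coe]
  unfold fSgn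
  rw [h]
  cases s <;> simp

lemma uSeq_eq (a : ℝ) (n : ℕ) : ∀ ε, uSeq a n ε = ((vSeq a n ε : ℝ) : EReal) := by
  induction n with
  | zero => intro ε; simp [uSeq, vSeq]
  | succ n ih => intro ε; simp only [uSeq, vSeq]; rw [ih, fSgn_coe]

lemma exp_le_e {a x : ℝ} (ha : 0 < a) (ha' : a ≤ 1 / Real.exp 1) (hx : x ≤ Real.exp 1) :
    Real.exp (a * x) ≤ Real.exp 1 := by
  apply Real.exp_le_exp.2
  have he := Real.exp_pos 1
  calc a * x ≤ a * Real.exp 1 := by gcongr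
    _ ≤ 1 / Real.exp 1 * Real.exp 1 := by gcongr
    _ = 1 := by field_simp

lemma vSeq_abs {a : ℝ} (ha : 0 < a) (ha' : a ≤ 1 / Real.exp 1) (n : ℕ) :
    ∀ ε, |vSeq a n ε| ≤ Real.exp 1 := by
  induction n with
  | zero =>
    intro ε
    have := Real.add_one_le_exp (1 : ℝ)
    simp only [vSeq, abs_one]; linarith
  | succ n ih =>
    intro ε
    have h := exp_le_e ha ha' (le_trans (le_abs_self _) (ih (fun k => ε (k + 1))))
    simp only [vSeq]
    split_ifs <;> simpa [abs_mul, Real.abs_exp] using h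

lemma phiMod_mono : Monotone phiMod := by
  intro x y h
  unfold phiMod
  have he := Real.exp_pos 1
  gcongr

lemma phiMod_contr' {a : ℝ} (ha : 0 < a) (ha' : a ≤ 1 / Real.exp 1) {x y : ℝ}
    (hxy : x ≤ y) (hy : y ≤ Real.exp 1) :
    |Real.exp (a * y) - Real.exp (a * x)| ≤ phiMod |y - x| := by
  have h1 : Real.exp (a * x) ≤ Real.exp (a * y) := Real.exp_le_exp.2 (by gcongr)
  rw [abs_of_nonneg (by linarith), abs_of_nonneg (by linarith)]
  have h2 : Real.exp (a * y) - Real.exp (a * x)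
      = Real.exp (a * y) * (1 - Real.exp (-(a * (y - x)))) := by
    rw [mul_sub, ← Real.exp_add]; ring_nf
  have h4 : a * (y - x) ≤ (y - x) / Real.exp 1 := by
    calc a * (y - x) ≤ 1 / Real.exp 1 * (y - x) :=
          mul_le_mul_of_nonneg_right ha' (by linarith)
      _ = _ := by ring
  have h5 : 0 ≤ a * (y - x) := mul_nonneg ha.le (by linarith)
  have h6 : Real.exp (-(a * (y - x))) ≤ 1 := Real.exp_le_one_iff.2 (by linarith)
  have h7 : Real.exp (-((y - x) / Real.exp 1)) ≤ Real.exp (-(a * (y - x))) :=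
    Real.exp_le_exp.2 (by linarith)
  rw [h2]
  unfold phiMod
  exact mul_le_mul (exp_le_e ha ha' hy) (by linarith) (by linarith) (Real.exp_pos 1).le

lemma phiMod_contr {a : ℝ} (ha : 0 < a) (ha' : a ≤ 1 / Real.exp 1) {x y : ℝ}
    (hx : x ≤ Real.exp 1) (hy : y ≤ Real.exp 1) :
    |Real.exp (a * y) - Real.exp (a * x)| ≤ phiMod |y - x| := by
  rcases le_total x y with h | h
  · exact phiMod_contr' ha ha' h hy
  · rw [abs_sub_comm, abs_sub_comm y x]
    exact phiMod_contr' ha ha' h hx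

lemma vSeq_cauchy {a : ℝ} (ha : 0 < a) (ha' : a ≤ 1 / Real.exp 1) (k n : ℕ) :
    ∀ ε, |vSeq a (n + k) ε - vSeq a n ε| ≤ phiMod^[n] (2 * Real.exp 1) := by
  induction n with
  | zero =>
    intro ε
    have h1 := vSeq_abs ha ha' (0 + k) ε
    have h2 := vSeq_abs ha ha' 0 ε
    have := abs_sub (vSeq a (0 + k) ε) (vSeq a 0 ε)
    simp only [Function.iterate_zero, id]
    linarith
  | succ n ih =>
    intro ε
    rw [Function.iterate_succ_apply', show n + 1 + k = (n + k) + 1 by ring]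
    simp only [vSeq]
    rw [← mul_sub, abs_mul]
    have h0 : |(if ε 0 then (1 : ℝ) else -1)| = 1 := by split_ifs <;> simp
    rw [h0, one_mul]
    refine le_trans (phiMod_contr ha ha' ?_ ?_) (phiMod_mono (ih _))
    · exact le_trans (le_abs_self _) (vSeq_abs ha ha' _ _)
    · exact le_trans (le_abs_self _) (vSeq_abs ha ha' _ _)

lemma phiMod_tendsto : Tendsto (fun n => phiMod^[n] (2 * Real.exp 1)) atTop (𝓝 0) := by
  have he := Real.exp_pos 1
  have hle : ∀ x, phiMod x ≤ x := by
    intro x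
    have := Real.add_one_le_exp (-(x / Real.exp 1))
    unfold phiMod
    calc _ ≤ Real.exp 1 * (x / Real.exp 1) := by gcongr; linarith
      _ = x := by field_simp
  have hnn : ∀ n, 0 ≤ phiMod^[n] (2 * Real.exp 1) := by
    intro n
    induction n with
    | zero => simp only [Function.iterate_zero, id]; positivity
    | succ n ih =>
      rw [Function.iterate_succ_apply']
      have h := phiMod_mono ih
      have h0 : phiMod 0 = 0 := by simp [phiMod]
      rwa [h0] at h
  have hanti : Antitone (fun n => phiMod^[n] (2 * Real.exp 1)) := by
    apply antitone_nat_of_succ_le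
    intro n
    rw [Function.iterate_succ_apply']
    exact hle _
  have hlim := tendsto_atTop_ciInf hanti ⟨0, by rintro _ ⟨n, rfl⟩; exact hnn n⟩
  set L := ⨅ n, phiMod^[n] (2 * Real.exp 1)
  have hcont : Continuous phiMod := by unfold phiMod; fun_prop
  have hfix : phiMod L = L := isFixedPt_of_tendsto_iterate hlim hcont.continuousAt
  have hL : L = 0 := by
    by_contra hne
    have h1 := Real.add_one_lt_exp (x := -(L / Real.exp 1)) (by
      simp [hne])
    have h2 : Real.exp 1 * (1 - Real.exp (-(L / Real.exp 1))) = L := hfix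
    have h3 : Real.exp 1 * (1 - Real.exp (-(L / Real.exp 1))) < Real.exp 1 * (L / Real.exp 1) :=
      mul_lt_mul_of_pos_left (by linarith) he
    rw [h2, mul_div_cancel₀ _ he.ne'] at h3
    exact lt_irrefl _ h3
  rwa [hL] at hlim

lemma vSeq_continuous (a : ℝ) (n : ℕ) : Continuous (vSeq a n) := by
  induction n with
  | zero => exact continuous_const
  | succ n ih =>
    have h1 : Continuous (fun b : Bool => if b then (1 : ℝ) else -1) := continuous_of_discreteTopology
    have h2 : Continuous (fun ε : ℕ → Bool => fun k => ε (k + 1)) := by fun_prop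
    exact (h1.comp (continuous_apply 0)).mul
      (Real.continuous_exp.comp (continuous_const.mul (ih.comp h2)))

/-- If `0 < a ≤ 1/e`, the set of representable elements is closed in `EReal`. -/
theorem isClosed_representable (a : ℝ) (ha : 0 < a) (ha' : a ≤ 1 / Real.exp 1) :
    IsClosed {t : EReal | Representable a t} := by
  have hex : ∀ ε, ∃ l, Tendsto (fun n => vSeq a n ε) atTop (𝓝 l) := by
    intro ε
    apply cauchySeq_tendsto_of_complete
    refine cauchySeq_of_le_tendsto_0' (fun n => phiMod^[n] (2 * Real.exp 1)) ?_ phiMod_tendsto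
    intro n m hnm
    obtain ⟨k, rfl⟩ := Nat.exists_eq_add_of_le hnm
    rw [dist_comm, Real.dist_eq]
    exact vSeq_cauchy ha ha' k n ε
  choose L hL using hex
  have hunif : TendstoUniformly (vSeq a) L atTop := by
    rw [Metric.tendstoUniformly_iff]
    intro r hr
    filter_upwards [phiMod_tendsto.eventually (gt_mem_nhds hr)] with n hn ε
    refine lt_of_le_of_lt ?_ hn
    have h1 : Tendsto (fun k => |vSeq a (n + k) ε - vSeq a n ε|) atTop
        (𝓝 |L ε - vSeq a n ε|) := by
      have h2 : Tendsto (fun k => vSeq a (n + k) ε) atTop (𝓝 (L ε)) := by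
        simpa only [add_comm] using (tendsto_add_atTop_iff_nat n).2 (hL ε)
      exact (h2.sub_const _).abs
    rw [Real.dist_eq]
    exact le_of_tendsto' h1 (fun k => vSeq_cauchy ha ha' k n ε)
  have hLc : Continuous L :=
    hunif.continuous (Eventually.of_forall (fun n => vSeq_continuous a n)).frequently
  have hrep : ∀ ε, Represents a ε ((L ε : ℝ) : EReal) := by
    intro ε
    unfold Represents
    simp only [uSeq_eq]
    exact (continuous_coe_real_ereal.tendsto _).comp (hL ε)
  have hset : {t : EReal | Representable a t} = Set.range (fun ε => ((L ε : ℝ) : EReal)) := by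
    ext t
    constructor
    · rintro ⟨ε, h⟩
      exact ⟨ε, tendsto_nhds_unique (hrep ε) h⟩
    · rintro ⟨ε, rfl⟩
      exact ⟨ε, hrep ε⟩
  rw [hset]
  exact (isCompact_range (continuous_coe_real_ereal.comp hLc)).isClosed
end

section
/- If a > e, then the real sequence defined by w₀ = 1 and w_{n+1} = -e^{a·w_n} has no limit in the extended real line EReal; equivalently, the sign sequence consisting only of - signs represents no element of EReal. -/
open Filter Topology

theorem w_no_real_limit (a : ℝ) (ha : Real.exp 1 < a)
    (w : ℕ → ℝ) (hw0 : w 0 = 1) (hw : ∀ n, w (n + 1) = -Real.exp (a * w n)) (L : ℝ)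
    (h : Tendsto w atTop (𝓝 L)) : False := by
  have ha0 : 0 < a := (Real.exp_pos 1).trans ha
  have hL : L = -Real.exp (a * L) := by
    have h1 : Tendsto (fun n => w (n + 1)) atTop (𝓝 L) := h.comp (tendsto_add_atTop_nat 1)
    have h2 : Tendsto (fun n => -Real.exp (a * w n)) atTop (𝓝 (-Real.exp (a * L))) :=
      ((Real.continuous_exp.tendsto _).comp (h.const_mul a)).neg
    exact tendsto_nhds_unique (h1.congr hw) h2
  have hE := Real.exp_pos (a * L)
  have hs : 1 < -(a * L) := by
    by_contra! hc
    have h1 : Real.exp (-1) ≤ Real.exp (a * L) := Real.exp_le_exp.2 (by linarith)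
    have h2 : Real.exp 1 * Real.exp (-1) = 1 := by rw [← Real.exp_add]; simp
    have h3 : a * Real.exp (a * L) ≤ 1 := by
      have : a * L = a * -Real.exp (a * L) := congrArg (a * ·) hL
      linarith
    nlinarith [Real.exp_pos (-1)]
  have hne : ∀ n, w n ≠ L := by
    intro n
    induction n with
    | zero => rw [hw0]; intro h1; linarith
    | succ n ih =>
      intro h1
      apply ih
      rw [hw, hL] at h1
      have h2 := Real.exp_injective (neg_injective h1)
      exact mul_left_cancel₀ ha0.ne' h2
  have hev : ∀ᶠ n in atTop, 1 < -(a * L) * Real.exp (a * (w n - L)) := by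
    have : Tendsto (fun n => -(a * L) * Real.exp (a * (w n - L))) atTop
        (𝓝 (-(a * L) * Real.exp (a * (L - L)))) :=
      ((Real.continuous_exp.tendsto _).comp ((h.sub_const L).const_mul a)).const_mul _
    simp only [sub_self, mul_zero, Real.exp_zero, mul_one] at this
    exact this.eventually_const_lt hs
  obtain ⟨N, hN⟩ := eventually_atTop.1 hev
  have step : ∀ n ≥ N, |w n - L| ≤ |w (n + 1) - L| := by
    intro n hn
    have h1 := hN n hn
    set y := a * (w n - L) with hy
    have h2 : w (n + 1) - L = L * (Real.exp y - 1) := by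
      have : Real.exp (a * w n) = Real.exp (a * L) * Real.exp y := by
        rw [← Real.exp_add]; congr 1; rw [hy]; ring
      rw [hw, this]
      have : Real.exp (a * L) = -L := by linarith
      rw [this]; ring
    have h3 : |y| ≤ -(a * L) * |Real.exp y - 1| := by
      rcases le_total 0 y with h0 | h0
      · have := Real.add_one_le_exp y
        rw [abs_of_nonneg h0, abs_of_nonneg (by linarith)]
        nlinarith
      · have h4 := Real.add_one_le_exp (-y)
        have h5 : Real.exp y * Real.exp (-y) = 1 := by rw [← Real.exp_add]; simp
        have h6 : Real.exp y ≤ 1 := Real.exp_le_one_iff.2 h0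
        rw [abs_of_nonpos h0, abs_of_nonpos (by linarith)]
        have h7 : Real.exp y * (-y) ≤ 1 - Real.exp y := by
          nlinarith [Real.exp_pos y]
        calc -y = 1 * -y := by ring
          _ ≤ (-(a * L) * Real.exp y) * -y :=
            mul_le_mul_of_nonneg_right h1.le (by linarith)
          _ = -(a * L) * (Real.exp y * -y) := by ring
          _ ≤ -(a * L) * (1 - Real.exp y) := mul_le_mul_of_nonneg_left h7 (by linarith)
          _ = _ := by ring
    have hLneg : L < 0 := by linarith
    rw [h2, abs_mul, abs_of_neg hLneg]
    rw [hy, abs_mul, abs_of_pos ha0, ← hy] at h3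
    refine le_of_mul_le_mul_left ?_ ha0
    linarith
  have hge : ∀ n ≥ N, |w N - L| ≤ |w n - L| := by
    intro n hn
    induction n, hn using Nat.le_induction with
    | base => exact le_rfl
    | succ n hn ih => exact ih.trans (step n hn)
  have hlim : Tendsto (fun n => |w n - L|) atTop (𝓝 0) := by
    simpa using (h.sub_const L).abs
  have := ge_of_tendsto hlim (eventually_atTop.2 ⟨N, hge⟩)
  exact absurd this (not_le.2 (abs_pos.2 (sub_ne_zero.2 (hne N))))

theorem w_no_limit (a : ℝ) (ha : Real.exp 1 < a)
    (w : ℕ → ℝ) (hw0 : w 0 = 1) (hw : ∀ n, w (n + 1) = -Real.exp (a * w n)) (t : EReal)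
    (h : Tendsto (fun n => ((w n : ℝ) : EReal)) atTop (𝓝 t)) : False := by
  have ha0 : 0 < a := (Real.exp_pos 1).trans ha
  have hub : ∀ n, w n ≤ 1 := by
    intro n
    cases n with
    | zero => exact hw0.le
    | succ n => rw [hw]; linarith [Real.exp_pos (a * w n)]
  have hlb : ∀ n, -Real.exp a ≤ w n := by
    intro n
    cases n with
    | zero => rw [hw0]; linarith [Real.exp_pos a]
    | succ n =>
      rw [hw]
      have : Real.exp (a * w n) ≤ Real.exp a := Real.exp_le_exp.2 (by nlinarith [hub n])
      linarith
  have h1 : t ≤ ((1 : ℝ) : EReal) :=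
    le_of_tendsto' h fun n => EReal.coe_le_coe_iff.2 (hub n)
  have h2 : ((-Real.exp a : ℝ) : EReal) ≤ t :=
    ge_of_tendsto' h fun n => EReal.coe_le_coe_iff.2 (hlb n)
  induction t with
  | bot => exact absurd h2 (not_le.2 (EReal.bot_lt_coe _))
  | top => exact absurd h1 (not_le.2 (EReal.coe_lt_top _))
  | coe L => exact w_no_real_limit a ha w hw0 hw L (EReal.tendsto_coe.1 h)

theorem eexp_coe (x : ℝ) : eexp (x : EReal) = ((Real.exp x : ℝ) : EReal) := by
  rw [eexp, if_neg (EReal.coe_ne_bot _), if_neg (EReal.coe_ne_top _), EReal.toReal_coe]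

theorem uSeq_eq_w (a : ℝ)
    (w : ℕ → ℝ) (hw0 : w 0 = 1) (hw : ∀ n, w (n + 1) = -Real.exp (a * w n)) (n : ℕ) :
    uSeq a n (fun _ => false) = ((w n : ℝ) : EReal) := by
  induction n with
  | zero => simp [uSeq, hw0]
  | succ n ih =>
    rw [uSeq, ih, hw]
    rw [fSgn, ← EReal.coe_mul, eexp_coe]
    simp

/-- If `a > e`, the sequence `w₀ = 1`, `w_{n+1} = -e^{a·w_n}` has no limit
in `EReal`; equivalently, the all-minus sign sequence represents no element of `EReal`. -/
theorem all_minus_diverges (a : ℝ) (ha : Real.exp 1 < a)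
    (w : ℕ → ℝ) (hw0 : w 0 = 1) (hw : ∀ n, w (n + 1) = -Real.exp (a * w n)) :
    (¬ ∃ t : EReal, Filter.Tendsto (fun n => ((w n : ℝ) : EReal)) Filter.atTop (nhds t)) ∧
      ∀ t : EReal, ¬ Represents a (fun _ => false) t := by
  refine ⟨fun ⟨t, ht⟩ => w_no_limit a ha w hw0 hw t ht, fun t ht => ?_⟩
  exact w_no_limit a ha w hw0 hw t (ht.congr fun n => uSeq_eq_w a w hw0 hw n)
end

section
/- Let a > 0, let ε be a sign sequence, and let t be an element of the interior (in EReal) of I(ε). If some sign sequence ε' represents t, then ε' = ε; in particular, ε itself represents t. Consequently, if I(ε) is not a subsingleton, then its interior contains at most one representable element. -/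
open Filter Topology

lemma eexp_eq (y : EReal) : eexp y = ((EReal.exp y : ENNReal) : EReal) := by
  induction y with
  | bot => simp [eexp]
  | top => simp [eexp]
  | coe x => simp [eexp, EReal.exp_coe, Real.exp_nonneg]

lemma fSgn_cont (a : ℝ) (ha : 0 < a) (s : Bool) : Continuous (fSgn a s) := by
  have h : Continuous fun x : EReal => eexp ((a : EReal) * x) := by
    simp only [eexp_eq]
    refine continuous_coe_ennreal_ereal.comp (ENNReal.continuous_exp.comp ?_)
    refine continuous_iff_continuousAt.2 fun x => ?_
    have ha0 : (a : EReal) ≠ 0 := by exact_mod_cast ha.ne'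
    exact ContinuousAt.comp (f := fun x : EReal => ((a : EReal), x)) (g := fun p => p.1 * p.2)
      (EReal.continuousAt_mul (Or.inl ha0) (Or.inl ha0) (Or.inl (by simp)) (Or.inl (by simp)))
      (by fun_prop)
  cases s
  · exact (continuous_neg.comp h).congr fun x => by simp [fSgn]
  · exact h.congr fun x => by simp [fSgn]

lemma fSgn_inj (a : ℝ) (ha : 0 < a) (s : Bool) : Function.Injective (fSgn a s) := by
  have h : Function.Injective fun x : EReal => eexp ((a : EReal) * x) := by
    intro x y hxy
    simp only [eexp_eq, EReal.coe_ennreal_eq_coe_ennreal_iff] at hxy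
    have h2 := EReal.exp_strictMono.injective hxy
    induction x <;> induction y <;>
      simp_all [EReal.coe_mul_top_of_pos, EReal.coe_mul_bot_of_pos, ← EReal.coe_mul, ha.ne']
  cases s
  · intro x y hxy
    exact h (by simpa [fSgn] using hxy)
  · intro x y hxy
    exact h (by simpa [fSgn] using hxy)

lemma fSgn_emb (a : ℝ) (ha : 0 < a) (s : Bool) : Topology.IsClosedEmbedding (fSgn a s) :=
  (fSgn_cont a ha s).isClosedEmbedding (fSgn_inj a ha s)

lemma fSgn_true_nonneg (a : ℝ) (x : EReal) : 0 ≤ fSgn a true x := by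
  simpa [fSgn, eexp_eq] using EReal.coe_ennreal_nonneg _

lemma fSgn_false_nonpos (a : ℝ) (x : EReal) : fSgn a false x ≤ 0 := by
  simpa [fSgn, eexp_eq] using EReal.coe_ennreal_nonneg _

lemma Iset_subset_range (a : ℝ) (ε : ℕ → Bool) : Iset a ε ⊆ Set.range (fSgn a (ε 0)) := by
  intro t ht
  obtain ⟨x, hx⟩ := Set.mem_iInter.1 ht 1
  exact ⟨x, by simpa [fWord] using hx⟩

lemma mem_Iset_shift (a : ℝ) (ha : 0 < a) (ε : ℕ → Bool) (x : EReal)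
    (h : fSgn a (ε 0) x ∈ Iset a ε) : x ∈ Iset a (fun k => ε (k + 1)) := by
  refine Set.mem_iInter.2 fun n => ?_
  obtain ⟨y, hy⟩ := Set.mem_iInter.1 h (n + 1)
  refine ⟨y, fSgn_inj a ha (ε 0) ?_⟩
  rw [← hy]
  simp [fWord, List.ofFn_succ]

lemma interior_shift (a : ℝ) (ha : 0 < a) (ε : ℕ → Bool) (x : EReal)
    (h : fSgn a (ε 0) x ∈ interior (Iset a ε)) :
    x ∈ interior (Iset a (fun k => ε (k + 1))) := by
  rw [mem_interior]
  exact ⟨fSgn a (ε 0) ⁻¹' interior (Iset a ε),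
    fun y hy => mem_Iset_shift a ha ε y (interior_subset hy),
    isOpen_interior.preimage (fSgn_cont a ha _), h⟩

lemma sign_eq (a : ℝ) (ε ε' : ℕ → Bool) (t : EReal)
    (ht : t ∈ interior (Iset a ε)) (h : Represents a ε' t) : ε' 0 = ε 0 := by
  have h' : Tendsto (fun n => uSeq a (n + 1) ε') atTop (𝓝 t) := h.comp (tendsto_add_atTop_nat 1)
  have hr := Iset_subset_range a ε
  cases h0 : ε 0 <;> cases h1 : ε' 0 <;> try rfl
  · exfalso
    have hsub : Iset a ε ⊆ Set.Iic 0 := by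
      rw [h0] at hr
      intro y hy
      obtain ⟨z, rfl⟩ := hr hy
      exact fSgn_false_nonpos a z
    have h2 := interior_mono hsub ht
    rw [interior_Iic' (by exact ⟨1, by simp⟩)] at h2
    have : (0 : EReal) ≤ t := ge_of_tendsto' h' fun n => by
      simp only [uSeq, h1]; exact fSgn_true_nonneg a _
    exact absurd h2 (not_lt.2 this)
  · exfalso
    have hsub : Iset a ε ⊆ Set.Ici 0 := by
      rw [h0] at hr
      intro y hy
      obtain ⟨z, rfl⟩ := hr hy
      exact fSgn_true_nonneg a z
    have h2 := interior_mono hsub ht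
    rw [interior_Ici' (by exact ⟨-1, by simp⟩)] at h2
    have : t ≤ (0 : EReal) := le_of_tendsto' h' fun n => by
      simp only [uSeq, h1]; exact fSgn_false_nonpos a _
    exact absurd h2 (not_lt.2 this)

lemma signs_eq (a : ℝ) (ha : 0 < a) (n : ℕ) : ∀ (ε ε' : ℕ → Bool) (t : EReal),
    t ∈ interior (Iset a ε) → Represents a ε' t → ε' n = ε n := by
  induction n with
  | zero => exact fun ε ε' t ht h => sign_eq a ε ε' t ht h
  | succ n ih =>
    intro ε ε' t ht h
    have h0 := sign_eq a ε ε' t ht h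
    obtain ⟨x, rfl⟩ := Iset_subset_range a ε (interior_subset ht)
    refine ih (fun k => ε (k + 1)) (fun k => ε' (k + 1)) x (interior_shift a ha ε x ht) ?_
    have h' : Tendsto (fun n => uSeq a (n + 1) ε') atTop (𝓝 (fSgn a (ε 0) x)) :=
      h.comp (tendsto_add_atTop_nat 1)
    simp only [uSeq, h0] at h'
    exact (fSgn_emb a ha (ε 0)).isEmbedding.tendsto_nhds_iff.2 h'

/-- If `t` lies in the interior of `I(ε)` and some `ε'` represents `t`,
then `ε' = ε` (in particular `ε` itself then represents `t`); consequently if `I(ε)` is not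
a subsingleton, its interior contains at most one representable element. -/
theorem interior_Iset_represented_only_by_eps (a : ℝ) (ha : 0 < a) (ε : ℕ → Bool) :
    (∀ t ∈ interior (Iset a ε), ∀ ε' : ℕ → Bool, Represents a ε' t → ε' = ε) ∧
      (∀ t ∈ interior (Iset a ε), (∃ ε' : ℕ → Bool, Represents a ε' t) → Represents a ε t) ∧
      (¬ (Iset a ε).Subsingleton →
        {t ∈ interior (Iset a ε) | Representable a t}.Subsingleton) := by
  have key : ∀ t ∈ interior (Iset a ε), ∀ ε' : ℕ → Bool, Represents a ε' t → ε' = ε :=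
    fun t ht ε' h => funext fun n => signs_eq a ha n ε ε' t ht h
  have key2 : ∀ t ∈ interior (Iset a ε), (∃ ε' : ℕ → Bool, Represents a ε' t) →
      Represents a ε t := by
    rintro t ht ⟨ε', h⟩
    exact key t ht ε' h ▸ h
  refine ⟨key, key2, fun _ => ?_⟩
  rintro t ⟨ht, hr⟩ s ⟨hs, hr'⟩
  exact tendsto_nhds_unique (key2 t ht hr) (key2 s hs hr')
end
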